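/- Inversion of the kinetic operator of the extended BFYM model (propagator matrix of Appendix A): for every p ∈ ℝ³ with p ≠ 0 and all α, β ∈ ℝ, the complex 9×9 block matrices, with blocks indexed by the field multiplet (A ∈ ℂ³, B ∈ ℂ³, η ∈ ℂ, b ∈ ℂ, h ∈ ℂ), K_ext(p) = [[0₃, E(p), 0, i·p, 0],[E(p), I₃, −i·p, 0, i·p],[0, i·pᵀ, ‖p‖², 0, 0],[−i·pᵀ, 0, 0, α, 0],[0, −i·pᵀ, 0, 0, β]] and Δ_ext(p) = [[P(p)/‖p‖² − α·p pᵀ/‖p‖⁴, −E(p)/‖p‖², 0, i·p/‖p‖², 0],[−E(p)/‖p‖², −β·p pᵀ/‖p‖⁴, −i β·p/‖p‖⁴, 0, i·p/‖p‖²],[0, i β·pᵀ/‖p‖⁴, 1/‖p‖² − β/‖p‖⁴, 0, 1/‖p‖²],[−i·pᵀ/‖p‖², 0, 0, 0, 0],[0, −i·pᵀ/‖p‖², 1/‖p‖², 0, 0]] satisfy Δ_ext(p)·K_ext(p) = I₉ and K_ext(p)·Δ_ext(p) = I₉. In particular K_ext(p) is invertible for all p ≠ 0, with inverse the extended BFYM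 propagator matrix Δ_ext(p). -/

import Mathlib

open Matrix Complex

noncomputable section

/-- The Levi-Civita symbol on `Fin 3`, with `eps 0 1 2 = 1`. -/
def eps (i j k : Fin 3) : ℝ :=
  if (i, j, k) = ((0 : Fin 3), (1 : Fin 3), (2 : Fin 3)) ∨
     (i, j, k) = ((1 : Fin 3), (2 : Fin 3), (0 : Fin 3)) ∨
     (i, j, k) = ((2 : Fin 3), (0 : Fin 3), (1 : Fin 3)) then 1
  else if (i, j, k) = ((2 : Fin 3), (1 : Fin 3), (0 : Fin 3)) ∨
     (i, j, k) = ((1 : Fin 3), (0 : Fin 3), (2 : Fin 3)) ∨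
     (i, j, k) = ((0 : Fin 3), (2 : Fin 3), (1 : Fin 3)) then -1
  else 0

/-- The momentum-space curl matrix `E(p) μ ν = ∑ ρ, ε μ ρ ν * p ρ`, as a complex matrix. -/
def curlE (p : EuclideanSpace ℝ (Fin 3)) : Matrix (Fin 3) (Fin 3) ℂ :=
  Matrix.of fun μ ν => ∑ ρ : Fin 3, (eps μ ρ ν : ℂ) * (p ρ : ℂ)

/-- `‖p‖²` as a complex number. -/
def nsq (p : EuclideanSpace ℝ (Fin 3)) : ℂ := ((‖p‖ : ℝ) : ℂ) ^ 2

/-- The index type of the extended BFYM multiplet `(A ∈ ℂ³, B ∈ ℂ³, η ∈ ℂ, b ∈ ℂ, h ∈ ℂ)`. -/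
abbrev ExtIdx : Type := Fin 3 ⊕ Fin 3 ⊕ Unit ⊕ Unit ⊕ Unit

/-- The momentum-space kinetic matrix `K_ext(p)` of the gauge-fixed extended BFYM model,
with blocks `[[0₃, E(p), 0, i·p, 0], [E(p), I₃, −i·p, 0, i·p], [0, i·pᵀ, ‖p‖², 0, 0],
[−i·pᵀ, 0, 0, α, 0], [0, −i·pᵀ, 0, 0, β]]`. -/
def Kext (α β : ℝ) (p : EuclideanSpace ℝ (Fin 3)) : Matrix ExtIdx ExtIdx ℂ :=
  Matrix.of fun i j =>
    match i, j with
    -- row A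
    | .inl _, .inl _ => 0
    | .inl μ, .inr (.inl ν) => curlE p μ ν
    | .inl _, .inr (.inr (.inl _)) => 0
    | .inl μ, .inr (.inr (.inr (.inl _))) => Complex.I * (p μ : ℂ)
    | .inl _, .inr (.inr (.inr (.inr _))) => 0
    -- row B
    | .inr (.inl μ), .inl ν => curlE p μ ν
    | .inr (.inl μ), .inr (.inl ν) => if μ = ν then 1 else 0
    | .inr (.inl μ), .inr (.inr (.inl _)) => -Complex.I * (p μ : ℂ)
    | .inr (.inl _), .inr (.inr (.inr (.inl _))) => 0
    | .inr (.inl μ), .inr (.inr (.inr (.inr _))) => Complex.I * (p μ : ℂ)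
    -- row η
    | .inr (.inr (.inl _)), .inl _ => 0
    | .inr (.inr (.inl _)), .inr (.inl ν) => Complex.I * (p ν : ℂ)
    | .inr (.inr (.inl _)), .inr (.inr (.inl _)) => nsq p
    | .inr (.inr (.inl _)), .inr (.inr (.inr _)) => 0
    -- row b
    | .inr (.inr (.inr (.inl _))), .inl ν => -Complex.I * (p ν : ℂ)
    | .inr (.inr (.inr (.inl _))), .inr (.inl _) => 0
    | .inr (.inr (.inr (.inl _))), .inr (.inr (.inl _)) => 0
    | .inr (.inr (.inr (.inl _))), .inr (.inr (.inr (.inl _))) => (α : ℂ)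
    | .inr (.inr (.inr (.inl _))), .inr (.inr (.inr (.inr _))) => 0
    -- row h
    | .inr (.inr (.inr (.inr _))), .inl _ => 0
    | .inr (.inr (.inr (.inr _))), .inr (.inl ν) => -Complex.I * (p ν : ℂ)
    | .inr (.inr (.inr (.inr _))), .inr (.inr (.inl _)) => 0
    | .inr (.inr (.inr (.inr _))), .inr (.inr (.inr (.inl _))) => 0
    | .inr (.inr (.inr (.inr _))), .inr (.inr (.inr (.inr _))) => (β : ℂ)

/-- The extended BFYM propagator matrix `Δ_ext(p)`, with blocks
`[[P(p)/‖p‖² − α·p pᵀ/‖p‖⁴, −E(p)/‖p‖², 0, i·p/‖p‖², 0],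
  [−E(p)/‖p‖², −β·p pᵀ/‖p‖⁴, −iβ·p/‖p‖⁴, 0, i·p/‖p‖²],
  [0, iβ·pᵀ/‖p‖⁴, 1/‖p‖² − β/‖p‖⁴, 0, 1/‖p‖²],
  [−i·pᵀ/‖p‖², 0, 0, 0, 0],
  [0, −i·pᵀ/‖p‖², 1/‖p‖², 0, 0]]`. -/
def DeltaExt (α β : ℝ) (p : EuclideanSpace ℝ (Fin 3)) : Matrix ExtIdx ExtIdx ℂ :=
  Matrix.of fun i j =>
    match i, j with
    -- row A
    | .inl μ, .inl ν =>
        ((if μ = ν then 1 else 0) - (p μ : ℂ) * (p ν : ℂ) / nsq p) / nsq p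
          - (α : ℂ) * (p μ : ℂ) * (p ν : ℂ) / (nsq p) ^ 2
    | .inl μ, .inr (.inl ν) => -(curlE p μ ν) / nsq p
    | .inl _, .inr (.inr (.inl _)) => 0
    | .inl μ, .inr (.inr (.inr (.inl _))) => Complex.I * (p μ : ℂ) / nsq p
    | .inl _, .inr (.inr (.inr (.inr _))) => 0
    -- row B
    | .inr (.inl μ), .inl ν => -(curlE p μ ν) / nsq p
    | .inr (.inl μ), .inr (.inl ν) => -(β : ℂ) * (p μ : ℂ) * (p ν : ℂ) / (nsq p) ^ 2
    | .inr (.inl μ), .inr (.inr (.inl _)) => -Complex.I * (β : ℂ) * (p μ : ℂ) / (nsq p) ^ 2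
    | .inr (.inl _), .inr (.inr (.inr (.inl _))) => 0
    | .inr (.inl μ), .inr (.inr (.inr (.inr _))) => Complex.I * (p μ : ℂ) / nsq p
    -- row η
    | .inr (.inr (.inl _)), .inl _ => 0
    | .inr (.inr (.inl _)), .inr (.inl ν) => Complex.I * (β : ℂ) * (p ν : ℂ) / (nsq p) ^ 2
    | .inr (.inr (.inl _)), .inr (.inr (.inl _)) => 1 / nsq p - (β : ℂ) / (nsq p) ^ 2
    | .inr (.inr (.inl _)), .inr (.inr (.inr (.inl _))) => 0
    | .inr (.inr (.inl _)), .inr (.inr (.inr (.inr _))) => 1 / nsq p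
    -- row b
    | .inr (.inr (.inr (.inl _))), .inl ν => -Complex.I * (p ν : ℂ) / nsq p
    | .inr (.inr (.inr (.inl _))), .inr _ => 0
    -- row h
    | .inr (.inr (.inr (.inr _))), .inl _ => 0
    | .inr (.inr (.inr (.inr _))), .inr (.inl ν) => -Complex.I * (p ν : ℂ) / nsq p
    | .inr (.inr (.inr (.inr _))), .inr (.inr (.inl _)) => 1 / nsq p
    | .inr (.inr (.inr (.inr _))), .inr (.inr (.inr _)) => 0

lemma curlE_eq (p : EuclideanSpace ℝ (Fin 3)) :
    curlE p = !![0, -(p 2 : ℂ), p 1; p 2, 0, -(p 0 : ℂ); -(p 1 : ℂ), p 0, 0] := by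
  ext i j
  fin_cases i <;> fin_cases j <;> simp [curlE, eps, Fin.sum_univ_three]

lemma nsq_eq (p : EuclideanSpace ℝ (Fin 3)) :
    nsq p = (p 0 : ℂ) ^ 2 + (p 1 : ℂ) ^ 2 + (p 2 : ℂ) ^ 2 := by
  have h := EuclideanSpace.real_norm_sq_eq p
  rw [Fin.sum_univ_three] at h
  unfold nsq
  exact_mod_cast h

set_option maxHeartbeats 4000000 in
lemma Kext_mul_DeltaExt (p : EuclideanSpace ℝ (Fin 3)) (hp : p ≠ 0) (α β : ℝ) :
    Kext α β p * DeltaExt α β p = 1 := by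
  have hn : nsq p ≠ 0 := by simpa [nsq] using hp
  have hs := nsq_eq p
  have hI : Complex.I ^ 2 = -1 := Complex.I_sq
  ext i j
  rcases i with i | i | i | i | i <;> rcases j with j | j | j | j | j <;>
    simp only [Matrix.mul_apply, Fintype.sum_sum_type, Fin.sum_univ_three, Kext, DeltaExt,
      curlE_eq, Matrix.one_apply, Matrix.of_apply, Finset.univ_unique, Finset.sum_singleton] <;>
    generalize nsq p = n at * <;>
    (try fin_cases i) <;> (try fin_cases j) <;>
    (try simp) <;> (try field_simp) <;> (try grind)

/-- Inversion of the kinetic operator of the extended BFYM model: for every `p ≠ 0`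
and all gauge parameters `α, β`, the extended propagator matrix `Δ_ext(p)` is a
two-sided inverse of the kinetic matrix `K_ext(p)`; in particular `K_ext(p)` is
invertible with inverse `Δ_ext(p)`. -/
theorem extended_BFYM_propagator_inverts_kinetic
    (p : EuclideanSpace ℝ (Fin 3)) (hp : p ≠ 0) (α β : ℝ) :
    DeltaExt α β p * Kext α β p = 1 ∧
    Kext α β p * DeltaExt α β p = 1 ∧
    IsUnit (Kext α β p) ∧
    (Kext α β p)⁻¹ = DeltaExt α β p := by
  have h2 := Kext_mul_DeltaExt p hp α β
  have h1 : DeltaExt α β p * Kext α β p = 1 := mul_eq_one_comm.mp h2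
  exact ⟨h1, h2, IsUnit.of_mul_eq_one _ h2, Matrix.inv_eq_right_inv h2⟩
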